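/- arXiv:2103.06699 — 2 statements merged into one kernel-verified Lean document; each statement's English description precedes it below -/
import Mathlib

section
/- The function Σ satisfies: Σ(t) = 0 if and only if t = kπ for some integer k; moreover Σ(t) < 0 for every t ∈ (0,π), and in particular Σ(π − nπ/(2√a')) < 0. -/
open Real

noncomputable section

/-- `C` is the asymmetric cosine of the pair `(a, b)` for the resonance integer `n`. -/
def IsAsymCos (n : ℕ) (a b : ℝ) (C : ℝ → ℝ) : Prop :=
  (∀ t, C (-t) = C t) ∧ (∀ t, C (t + 2 * π / n) = C t) ∧
  (∀ t ∈ Set.Icc (0 : ℝ) (π / (2 * Real.sqrt a)), C t = Real.cos (Real.sqrt a * t)) ∧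
  (∀ t ∈ Set.Icc (π / (2 * Real.sqrt a)) (π / n),
      C t = - Real.sqrt (a / b) * Real.sin (Real.sqrt b * (t - π / (2 * Real.sqrt a))))

theorem asymCos_anti (n : ℕ) (hn : 1 ≤ n) (a b : ℝ)
    (ha : (n : ℝ) ^ 2 / 4 < a) (hb : 0 < b)
    (hres : 1 / Real.sqrt a + 1 / Real.sqrt b = 2 / (n : ℝ))
    (C : ℝ → ℝ) (hC : IsAsymCos n a b C) : StrictAntiOn C (Set.Icc 0 (π / n)) := by
  obtain ⟨-, -, h1, h2⟩ := hC
  have hnp : (0 : ℝ) < n := by exact_mod_cast hn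
  have ha0 : 0 < a := lt_trans (by positivity) ha
  have hsa : 0 < Real.sqrt a := Real.sqrt_pos.2 ha0
  have hsb : 0 < Real.sqrt b := Real.sqrt_pos.2 hb
  have hsab : 0 < Real.sqrt (a / b) := Real.sqrt_pos.2 (div_pos ha0 hb)
  have hpi := Real.pi_pos
  have hq : π / n - π / (2 * Real.sqrt a) = π / (2 * Real.sqrt b) := by
    have e1 : π / n = π / 2 * (2 / n) := by field_simp
    rw [e1, ← hres]; field_simp; ring
  have hqpos : 0 < π / (2 * Real.sqrt b) := by positivity
  have hqa : 0 < π / (2 * Real.sqrt a) := by positivity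
  have ea : Real.sqrt a * (π / (2 * Real.sqrt a)) = π / 2 := by field_simp
  have eb : Real.sqrt b * (π / (2 * Real.sqrt b)) = π / 2 := by field_simp
  have s1 : StrictAntiOn C (Set.Icc 0 (π / (2 * Real.sqrt a))) := by
    intro x hx y hy hxy
    rw [h1 x hx, h1 y hy]
    apply Real.cos_lt_cos_of_nonneg_of_le_pi
    · exact mul_nonneg hsa.le hx.1
    · have := mul_le_mul_of_nonneg_left hy.2 hsa.le
      linarith
    · exact mul_lt_mul_of_pos_left hxy hsa
  have s2 : StrictAntiOn C (Set.Icc (π / (2 * Real.sqrt a)) (π / n)) := by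
    intro x hx y hy hxy
    rw [h2 x hx, h2 y hy]
    have : Real.sin (Real.sqrt b * (x - π / (2 * Real.sqrt a)))
        < Real.sin (Real.sqrt b * (y - π / (2 * Real.sqrt a))) := by
      apply Real.sin_lt_sin_of_lt_of_le_pi_div_two
      · have := mul_nonneg hsb.le (sub_nonneg.2 hx.1)
        linarith
      · have : y - π / (2 * Real.sqrt a) ≤ π / (2 * Real.sqrt b) := by linarith [hy.2]
        have := mul_le_mul_of_nonneg_left this hsb.le
        linarith
      · exact mul_lt_mul_of_pos_left (by linarith) hsb
    have := mul_lt_mul_of_pos_left this hsab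
    linarith
  intro x hx y hy hxy
  rcases le_total y (π / (2 * Real.sqrt a)) with h | h
  · exact s1 ⟨hx.1, by linarith⟩ ⟨hy.1, h⟩ hxy
  rcases le_total (π / (2 * Real.sqrt a)) x with h' | h'
  · exact s2 ⟨h', hx.2⟩ ⟨h, hy.2⟩ hxy
  have m1 : C (π / (2 * Real.sqrt a)) ≤ C x :=
    s1.antitoneOn ⟨hx.1, h'⟩ ⟨hqa.le, le_rfl⟩ h'
  have m2 : C y ≤ C (π / (2 * Real.sqrt a)) :=
    s2.antitoneOn ⟨le_rfl, by linarith⟩ ⟨h, hy.2⟩ h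
  rcases h'.lt_or_eq with h3 | h3
  · exact m2.trans_lt (s1 ⟨hx.1, h'⟩ ⟨hqa.le, le_rfl⟩ h3)
  · exact (s2 ⟨le_rfl, by linarith⟩ ⟨h, hy.2⟩ (by linarith)).trans_le m1

theorem stmt1 (n : ℕ) (hn : 1 ≤ n) (a b a' : ℝ)
    (ha : (n : ℝ) ^ 2 / 4 < a) (hb : 0 < b)
    (hres : 1 / Real.sqrt a + 1 / Real.sqrt b = 2 / (n : ℝ))
    (ha' : (n : ℝ) ^ 2 / 4 < a')
    (C : ℝ → ℝ) (hC : IsAsymCos n a b C)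
    (Sig : ℝ → ℝ)
    (hSig : ∀ t, Sig t = C (t / n + π / (2 * Real.sqrt a')) - C (t / n - π / (2 * Real.sqrt a'))) :
    (∀ t, Sig t = 0 ↔ ∃ k : ℤ, t = k * π) ∧
    (∀ t ∈ Set.Ioo (0 : ℝ) π, Sig t < 0) ∧
    Sig (π - n * π / (2 * Real.sqrt a')) < 0 := by
  have hanti := asymCos_anti n hn a b ha hb hres C hC
  obtain ⟨hev, hper, -, -⟩ := hC
  have hnp : (0 : ℝ) < n := by exact_mod_cast hn
  have hpi := Real.pi_pos
  have hs : (n : ℝ) / 2 < Real.sqrt a' := by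
    apply Real.lt_sqrt_of_sq_lt
    linarith [show ((n : ℝ) / 2) ^ 2 = (n : ℝ) ^ 2 / 4 by ring]
  have hs0 : 0 < Real.sqrt a' := lt_trans (by positivity) hs
  have hnh : n * π / (2 * Real.sqrt a') = n * (π / (2 * Real.sqrt a')) := by ring
  have hh0 : 0 < π / (2 * Real.sqrt a') := by positivity
  have hhP : π / (2 * Real.sqrt a') < π / n :=
    div_lt_div_of_pos_left hpi hnp (by linarith)
  rw [hnh]
  generalize π / (2 * Real.sqrt a') = h at *
  have hP2 : 2 * π / n = 2 * (π / n) := by ring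
  have hper' : Function.Periodic C (2 * (π / n)) := fun t => by rw [← hP2]; exact hper t
  have hnP : n * (π / n) = π := by field_simp
  have hneg : ∀ t ∈ Set.Ioo (0 : ℝ) π, Sig t < 0 := by
    intro t ht
    rw [hSig]
    have hx0 : 0 < t / n := div_pos ht.1 hnp
    have hxP : t / n < π / n := div_lt_div_of_pos_right ht.2 hnp
    generalize t / n = x at *
    have habs : C (x - h) = C |x - h| := by
      rcases abs_cases (x - h) with ⟨e, -⟩ | ⟨e, -⟩
      · rw [e]
      · rw [e, hev]
    have hP : |x - h| ≤ π / n := by rw [abs_le]; constructor <;> linarith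
    rw [habs, sub_neg]
    rcases le_total (x + h) (π / n) with hc | hc
    · apply hanti ⟨abs_nonneg _, hP⟩ ⟨by linarith, hc⟩
      rw [abs_lt]; constructor <;> linarith
    · have : C (x + h) = C (2 * (π / n) - (x + h)) := by
        rw [← hev (x + h), ← hper' (-(x + h))]; ring_nf
      rw [this]
      apply hanti ⟨abs_nonneg _, hP⟩ ⟨by linarith, by linarith⟩
      rw [abs_lt]; constructor <;> linarith
  have hSper : Function.Periodic Sig (2 * π) := by
    intro t
    rw [hSig, hSig, ← hper' (t / n + h), ← hper' (t / n - h)]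
    congr 2 <;> ring
  have hSodd : ∀ t, Sig (-t) = - Sig t := by
    intro t
    rw [hSig, hSig, ← hev (-t / n + h), ← hev (-t / n - h)]
    rw [show -(-t / n + h) = t / n - h by ring, show -(-t / n - h) = t / n + h by ring]
    ring
  have hS0 : Sig 0 = 0 := by have := hSodd 0; rw [neg_zero] at this; linarith
  have hSpi : Sig π = 0 := by
    have e1 := hSodd π
    have e2 := hSper (-π)
    rw [show -π + 2 * π = π by ring] at e2
    linarith
  -- reduction of `r + k π`
  have hred : ∀ (r : ℝ) (k : ℤ), Sig (r + k * π) = Sig r ∨ Sig (r + k * π) = - Sig (π - r) := by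
    intro r k
    rcases Int.even_or_odd' k with ⟨m, hm | hm⟩
    · left
      rw [← hSper.int_mul m r, hm]; push_cast; ring_nf
    · right
      rw [← hSodd, ← hSper.int_mul (m + 1) (-(π - r)), hm]; push_cast; ring_nf
  refine ⟨?_, hneg, ?_⟩
  · intro t
    constructor
    · intro ht
      refine ⟨⌊t / π⌋, ?_⟩
      have f1 : (⌊t / π⌋ : ℝ) * π ≤ t := (le_div_iff₀ hpi).1 (Int.floor_le _)
      have f2 : t < (⌊t / π⌋ + 1 : ℝ) * π := (div_lt_iff₀ hpi).1 (Int.lt_floor_add_one _)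
      generalize ⌊t / π⌋ = k at *
      by_contra hne
      have f3 : 0 < t - k * π := sub_pos.2 (lt_of_le_of_ne f1 (Ne.symm hne))
      have f4 : t - k * π < π := by linarith
      have g1 := hneg _ ⟨f3, f4⟩
      have g2 := hneg (π - (t - k * π)) ⟨by linarith, by linarith⟩
      have := hred (t - k * π) k
      rw [sub_add_cancel] at this
      rcases this with e | e <;> linarith
    · rintro ⟨k, rfl⟩
      have := hred 0 k
      rw [zero_add, sub_zero] at this
      rcases this with e | e <;> linarith
  · apply hneg
    have := mul_lt_mul_of_pos_left hhP hnp
    have := mul_pos hnp hh0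
    constructor <;> linarith
end
end

section
/- Let L : ℝ² → ℝ² be C¹ and 2π-periodic in each variable, and let F = (F₁,F₂), G = (G₁,G₂) : ℝ² × (0,∞)² → ℝ² be continuous, 2π-periodic in each angular variable, and such that for every δ > 0 there exists M > 0 with ‖F(θ,r)‖ ≤ δ and ‖G(θ,r)‖ ≤ δ whenever min(r₁,r₂) ≥ M (uniformly in θ ∈ ℝ²). Suppose there exists ω ∈ ℝ² with L(ω) = 0 and JL(ω) a D⁺-matrix. Then there exist R > 0, Θ ∈ (0,π), λ > 0 and η ∈ (0,λ) such that, setting E = {(θ,r) ∈ ℝ² × (0,∞)² : r₁ ≥ R, r₂ ≥ R, λ − η ≤ r₁/r₂ ≤ λ + η, d_T(θ,ω) ≤ Θ} and f(θ,r) = (u,ρ) with u_i = θ_i + (L_i(θ) + G_i(θ,r))/r_i and ρ_i = r_i − ∂L_i/∂θ_i(θ) + F_i(θ,r): for every (θ⁰,r⁰) ∈ E, the recursively defined sequence (θ^{k+1}, r^{k+1}) = f(θ^k, r^k) remains in E for all k ≥ 0 and satisfies lim_{k→∞} r^k_i = +∞ for i = 1,2. -/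
open Real Filter

noncomputable section

/-- Euclidean norm of a point of `ℝ²` (written as a pair). -/
def enorm2 (v : ℝ × ℝ) : ℝ := Real.sqrt (v.1 ^ 2 + v.2 ^ 2)

/-- The torus distance between two points of `ℝ²` (identified modulo `2π` in each variable). -/
def torusDist (θ ω : ℝ × ℝ) : ℝ :=
  Real.sqrt ((⨅ k : ℤ, |θ.1 - ω.1 + 2 * k * π|) ^ 2 + (⨅ k : ℤ, |θ.2 - ω.2 + 2 * k * π|) ^ 2)

lemma inf_attained (x : ℝ) : ∃ k : ℤ, (⨅ k : ℤ, |x + 2 * k * π|) = |x + 2 * k * π| := by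
  have hb : BddBelow (Set.range fun k : ℤ => |x + 2 * k * π|) :=
    ⟨0, by rintro _ ⟨k, rfl⟩; positivity⟩
  have hp := Real.pi_pos
  refine ⟨-round (x / (2 * π)), le_antisymm (ciInf_le hb _) (le_ciInf fun m => ?_)⟩
  have h := round_le (x / (2 * π)) (-m)
  have e : ∀ z : ℤ, |x + 2 * ((-z : ℤ) : ℝ) * π| = 2 * π * |x / (2 * π) - z| := by
    intro z
    rw [← abs_of_pos (show 0 < 2 * π by positivity), ← abs_mul,
      abs_of_pos (show 0 < 2 * π by positivity)]
    congr 1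
    push_cast
    field_simp
    ring
  have e2 := e (-m)
  rw [neg_neg] at e2
  rw [e, e2]
  exact mul_le_mul_of_nonneg_left h (by positivity)

lemma inf_le_int (x : ℝ) (k : ℤ) : (⨅ k : ℤ, |x + 2 * k * π|) ≤ |x + 2 * k * π| :=
  ciInf_le ⟨0, by rintro _ ⟨k, rfl⟩; positivity⟩ k

lemma inf_nonneg_int (x : ℝ) : 0 ≤ (⨅ k : ℤ, |x + 2 * k * π|) :=
  le_ciInf fun _ => abs_nonneg _

lemma torus_le_iff (θ ω : ℝ × ℝ) (T : ℝ) (hT : 0 ≤ T) : torusDist θ ω ≤ T ↔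
    ∃ k l : ℤ, (θ.1 - ω.1 + 2 * k * π) ^ 2 + (θ.2 - ω.2 + 2 * l * π) ^ 2 ≤ T ^ 2 := by
  unfold torusDist
  rw [Real.sqrt_le_left hT]
  constructor
  · intro h
    obtain ⟨k, hk⟩ := inf_attained (θ.1 - ω.1)
    obtain ⟨l, hl⟩ := inf_attained (θ.2 - ω.2)
    rw [hk, hl, sq_abs, sq_abs] at h
    exact ⟨k, l, h⟩
  · rintro ⟨k, l, h⟩
    have h1 := pow_le_pow_left₀ (inf_nonneg_int _) (inf_le_int (θ.1 - ω.1) k) 2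
    have h2 := pow_le_pow_left₀ (inf_nonneg_int _) (inf_le_int (θ.2 - ω.2) l) 2
    rw [sq_abs] at h1 h2
    linarith

lemma per_int (L : ℝ × ℝ → ℝ) (h1 : ∀ θ : ℝ × ℝ, L (θ.1 + 2 * π, θ.2) = L θ)
    (h2 : ∀ θ : ℝ × ℝ, L (θ.1, θ.2 + 2 * π) = L θ) (k l : ℤ) (θ : ℝ × ℝ) :
    L (θ + (2 * k * π, 2 * l * π)) = L θ := by
  have a1 : ∀ y, Function.Periodic (fun x => L (x, y)) (2 * π) := fun y x => h1 (x, y)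
  have a2 : ∀ x, Function.Periodic (fun y => L (x, y)) (2 * π) := fun x y => h2 (x, y)
  have b1 := (a1 (θ.2 + 2 * l * π)).int_mul k θ.1
  have b2 := (a2 θ.1).int_mul l θ.2
  have : θ + (2 * (k : ℝ) * π, 2 * (l : ℝ) * π) = (θ.1 + k * (2 * π), θ.2 + 2 * l * π) := by
    ext <;> simp <;> ring
  rw [this, b1, show θ.2 + 2 * (l : ℝ) * π = θ.2 + l * (2 * π) by ring, b2]

lemma fderiv_per_int (L : ℝ × ℝ → ℝ) (h1 : ∀ θ : ℝ × ℝ, L (θ.1 + 2 * π, θ.2) = L θ)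
    (h2 : ∀ θ : ℝ × ℝ, L (θ.1, θ.2 + 2 * π) = L θ) (k l : ℤ) (θ : ℝ × ℝ) :
    fderiv ℝ L (θ + (2 * k * π, 2 * l * π)) = fderiv ℝ L θ := by
  rw [← fderiv_comp_add_right]
  congr 1
  funext x
  exact per_int L h1 h2 k l x

/-- Negative definiteness with perturbations. -/
lemma quad_neg (a b c d : ℝ) (ha : 0 < a) (hd : 0 < d) (h : |b * d + a * c| < 2 * (a * d)) :
    ∃ κ > 0, ∃ τ > 0, ∃ ε > 0, ∀ ν x y e1 e2 : ℝ, 0 < ν → |ν - d / a| ≤ τ →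
      |e1| ≤ ε * (|x| + |y|) → |e2| ≤ ε * (|x| + |y|) →
      ν * (x * (-a * x + b * y + e1)) + y * (c * x - d * y + e2) ≤ -κ * (x ^ 2 + y ^ 2) := by
  obtain ⟨ν0, hν0⟩ : ∃ ν0, ν0 = d / a := ⟨_, rfl⟩
  have hν0pos : 0 < ν0 := by rw [hν0]; positivity
  have hν0a : ν0 * a = d := by rw [hν0]; field_simp
  obtain ⟨m, hm⟩ : ∃ m, m = b * ν0 + c := ⟨_, rfl⟩
  have hmabs : |m| < 2 * d := by
    have : b * d + a * c = a * m := by rw [hm, ← hν0a]; ring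
    rw [this, abs_mul, abs_of_pos ha] at h
    have : a * |m| < a * (2 * d) := by linarith
    exact lt_of_mul_lt_mul_left this ha.le
  obtain ⟨κ, hκ⟩ : ∃ κ, κ = (d - |m| / 2) / 2 := ⟨_, rfl⟩
  have hκpos : 0 < κ := by rw [hκ]; linarith
  have hab : 0 < a + |b| := by positivity
  refine ⟨κ, hκpos, min 1 (κ / 2 / (a + |b|)), by positivity, κ / 2 / (2 * (ν0 + 2)),
    by positivity, ?_⟩
  intro ν x y e1 e2 hν hτ h1 h2
  rw [← hν0] at hτ
  have hτ1 := hτ.trans (min_le_left _ _)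
  have hτ2 : |ν - ν0| * (a + |b|) ≤ κ / 2 := by
    rw [← le_div_iff₀ hab]; exact hτ.trans (min_le_right _ _)
  set ε := κ / 2 / (2 * (ν0 + 2)) with hε
  have hε0 : 0 < ε := by positivity
  have hε2 : ε * (2 * (ν0 + 2)) = κ / 2 := by rw [hε]; field_simp
  have hνle : ν ≤ ν0 + 1 := by linarith [le_abs_self (ν - ν0)]
  set s := x ^ 2 + y ^ 2 with hs
  have hs0 : 0 ≤ s := by positivity
  have hxy : |x| * |y| ≤ s / 2 := by
    nlinarith [sq_nonneg (|x| - |y|), sq_abs x, sq_abs y]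
  have hx2 : |x| * |x| ≤ s := by nlinarith [sq_abs x, sq_nonneg y]
  have hy2 : |y| * |y| ≤ s := by nlinarith [sq_abs y, sq_nonneg x]
  have t1 : m * (x * y) ≤ |m| * (s / 2) := by
    calc m * (x * y) ≤ |m * (x * y)| := le_abs_self _
      _ = |m| * (|x| * |y|) := by rw [abs_mul, abs_mul]
      _ ≤ _ := by gcongr
  have t2 : (ν - ν0) * (x * (-a * x + b * y)) ≤ κ / 2 * s := by
    have : |x * (-a * x + b * y)| ≤ (a + |b|) * s := by
      calc |x * (-a * x + b * y)| = |x| * |-a * x + b * y| := abs_mul _ _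
        _ ≤ |x| * (|-a * x| + |b * y|) := by gcongr; exact abs_add_le _ _
        _ = a * (|x| * |x|) + |b| * (|x| * |y|) := by
          rw [abs_mul, abs_mul, abs_neg, abs_of_pos ha]; ring
        _ ≤ a * s + |b| * s := by gcongr; linarith
        _ = _ := by ring
    calc _ ≤ |(ν - ν0) * (x * (-a * x + b * y))| := le_abs_self _
      _ = |ν - ν0| * |x * (-a * x + b * y)| := abs_mul _ _
      _ ≤ |ν - ν0| * ((a + |b|) * s) := by gcongr
      _ = |ν - ν0| * (a + |b|) * s := by ring
      _ ≤ _ := by gcongr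
  have t3 : x * e1 ≤ ε * (2 * s) := by
    calc _ ≤ |x * e1| := le_abs_self _
      _ = |x| * |e1| := abs_mul _ _
      _ ≤ |x| * (ε * (|x| + |y|)) := by gcongr
      _ = ε * (|x| * |x| + |x| * |y|) := by ring
      _ ≤ _ := by gcongr; linarith
  have t4 : y * e2 ≤ ε * (2 * s) := by
    calc _ ≤ |y * e2| := le_abs_self _
      _ = |y| * |e2| := abs_mul _ _
      _ ≤ |y| * (ε * (|x| + |y|)) := by gcongr
      _ = ε * (|y| * |y| + |x| * |y|) := by ring
      _ ≤ _ := by gcongr; linarith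
  have t5 : ν * (x * e1) ≤ (ν0 + 1) * (ε * (2 * s)) := by
    calc _ ≤ ν * (ε * (2 * s)) := by gcongr
      _ ≤ _ := by gcongr
  have key : ν * (x * (-a * x + b * y + e1)) + y * (c * x - d * y + e2) =
      -d * s + m * (x * y) + (ν - ν0) * (x * (-a * x + b * y)) + ν * (x * e1) + y * e2 := by
    rw [hm, hs, ← hν0a]; ring
  have hfin : (ν0 + 1) * (ε * (2 * s)) + ε * (2 * s) = κ / 2 * s := by
    rw [← hε2]; ring
  have h6 : -d * s + |m| * (s / 2) = - (2 * κ) * s := by rw [hκ]; ring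
  rw [key]
  linarith

/-- One angular step. -/
lemma ang_step (κ N δ T R : ℝ) (hκ : 0 < κ) (hN : 0 < N) (hT : 0 < T)
    (hδ : 2 * ((N + 1) * δ) ≤ κ * T) (hR1 : 2 * κ ≤ R)
    (hR2 : 4 * (N ^ 2 + 1) ≤ R * (κ * T ^ 2))
    (x y l1 l2 g1 g2 r q : ℝ) (hr : 0 < r) (hq0 : 0 < q) (hq : R ≤ q) (hν : q / r ≤ N)
    (hs : x ^ 2 + y ^ 2 ≤ T ^ 2) (hg1 : |g1| ≤ δ) (hg2 : |g2| ≤ δ)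
    (hP1 : |l1 + g1| ≤ 2) (hP2 : |l2 + g2| ≤ 2)
    (hquad : q / r * (x * l1) + y * l2 ≤ -κ * (x ^ 2 + y ^ 2)) :
    (x + (l1 + g1) / r) ^ 2 + (y + (l2 + g2) / q) ^ 2 ≤ T ^ 2 := by
  obtain ⟨ν, hνd⟩ : ∃ ν, ν = q / r := ⟨_, rfl⟩
  rw [← hνd] at hν hquad
  have hν0 : 0 < ν := by rw [hνd]; positivity
  have e1 : (l1 + g1) / r = ν * (l1 + g1) / q := by rw [hνd]; field_simp
  have hδ0 : 0 ≤ δ := (abs_nonneg _).trans hg1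
  have hx : |x| ≤ T := abs_le_of_sq_le_sq (by linarith [sq_nonneg y]) hT.le
  have hy : |y| ≤ T := abs_le_of_sq_le_sq (by linarith [sq_nonneg x]) hT.le
  have t1 : ν * (x * g1) ≤ N * (T * δ) := by
    calc _ ≤ |ν * (x * g1)| := le_abs_self _
      _ = ν * (|x| * |g1|) := by rw [abs_mul, abs_mul, abs_of_pos hν0]
      _ ≤ _ := by gcongr
  have t2 : y * g2 ≤ T * δ := by
    calc _ ≤ |y * g2| := le_abs_self _
      _ = (|y| * |g2|) := by rw [abs_mul]
      _ ≤ _ := by gcongr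
  have p1 : (l1 + g1) ^ 2 ≤ 4 := by
    rw [← sq_abs]; nlinarith [abs_nonneg (l1 + g1)]
  have p2 : (l2 + g2) ^ 2 ≤ 4 := by
    rw [← sq_abs]; nlinarith [abs_nonneg (l2 + g2)]
  have t3 : ν ^ 2 * (l1 + g1) ^ 2 + (l2 + g2) ^ 2 ≤ q * (κ * T ^ 2) := by
    calc _ ≤ N ^ 2 * 4 + 4 := by gcongr
      _ = 4 * (N ^ 2 + 1) := by ring
      _ ≤ R * (κ * T ^ 2) := hR2
      _ ≤ _ := by gcongr
  have t4 : 2 * (N * (T * δ) + T * δ) ≤ κ * T ^ 2 := by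
    have := mul_le_mul_of_nonneg_right hδ hT.le
    linarith
  set s := x ^ 2 + y ^ 2 with hsd
  have key : ((x + (l1 + g1) / r) ^ 2 + (y + (l2 + g2) / q) ^ 2) * q ^ 2 =
      s * q ^ 2 + 2 * q * ((ν * (x * l1) + y * l2) + ν * (x * g1) + y * g2)
        + (ν ^ 2 * (l1 + g1) ^ 2 + (l2 + g2) ^ 2) := by
    rw [e1, hsd]; field_simp; ring
  have t5 : 2 * q * ((ν * (x * l1) + y * l2) + ν * (x * g1) + y * g2) ≤
      q * (-(2 * κ) * s + κ * T ^ 2) := by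
    have : 2 * ((ν * (x * l1) + y * l2) + ν * (x * g1) + y * g2) ≤ -(2 * κ) * s + κ * T ^ 2 := by
      linarith
    have := mul_le_mul_of_nonneg_left this hq0.le
    linarith
  have t6 : 0 ≤ q * (q - 2 * κ) * (T ^ 2 - s) :=
    mul_nonneg (mul_nonneg hq0.le (by linarith)) (by linarith)
  refine le_of_mul_le_mul_right (a := q ^ 2) ?_ (by positivity)
  rw [key]
  have t7 : s * q ^ 2 + q * (-(2 * κ) * s + κ * T ^ 2) + q * (κ * T ^ 2) ≤ T ^ 2 * q ^ 2 := by
    clear_value s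
    clear key t5 t3
    linarith
  exact (add_le_add (add_le_add le_rfl t5) t3).trans t7

/-- One radial step. -/
lemma rad_step (a d lam η e : ℝ) (hlam : lam * d = a) (hη : 0 < η) (hηl : η < lam)
    (he1 : 2 * e ≤ a) (he2 : 2 * e ≤ d) (he3 : e * (1 + lam + η) ≤ η * d) (he : 0 < e)
    (r q A B : ℝ) (hr : 0 < r) (hq : 0 < q) (hA : |A - a| ≤ e) (hB : |B - d| ≤ e)
    (h1 : lam - η ≤ r / q) (h2 : r / q ≤ lam + η) :
    r + e ≤ r + A ∧ q + e ≤ q + B ∧ lam - η ≤ (r + A) / (q + B) ∧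
      (r + A) / (q + B) ≤ lam + η := by
  rw [abs_le] at hA hB
  have hqB : 0 < q + B := by linarith
  rw [le_div_iff₀ hq] at h1
  rw [div_le_iff₀ hq] at h2
  refine ⟨by linarith, by linarith, ?_, ?_⟩
  · rw [le_div_iff₀ hqB]
    have : (lam - η) * B ≤ (lam - η) * (d + e) :=
      mul_le_mul_of_nonneg_left (by linarith) (by linarith)
    nlinarith
  · rw [div_le_iff₀ hqB]
    have : (lam + η) * (d - e) ≤ (lam + η) * B :=
      mul_le_mul_of_nonneg_left (by linarith) (by linarith)
    nlinarith

/-- Local control of a C¹ function near `ω`. -/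
lemma local_ctrl (L : ℝ × ℝ → ℝ) (hL : ContDiff ℝ 1 L) (ω v : ℝ × ℝ) (h0 : L ω = 0)
    (ε e : ℝ) (hε : 0 < ε) (he : 0 < e) : ∃ T > 0, ∀ θ : ℝ × ℝ,
      (θ.1 - ω.1) ^ 2 + (θ.2 - ω.2) ^ 2 ≤ T ^ 2 →
      |L θ| ≤ 1 ∧ |fderiv ℝ L θ v - fderiv ℝ L ω v| ≤ e ∧
      |L θ - (fderiv ℝ L ω (1, 0) * (θ.1 - ω.1) + fderiv ℝ L ω (0, 1) * (θ.2 - ω.2))| ≤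
        ε * (|θ.1 - ω.1| + |θ.2 - ω.2|) := by
  have c1 : ∀ᶠ θ in nhds ω, |L θ| < 1 := by
    have : Tendsto (fun θ => |L θ|) (nhds ω) (nhds |L ω|) := (hL.continuous.abs).tendsto ω
    rw [h0, abs_zero] at this
    exact this.eventually_lt_const one_pos
  have c2 : ∀ᶠ θ in nhds ω, |fderiv ℝ L θ v - fderiv ℝ L ω v| < e := by
    have hc : Continuous fun θ => |fderiv ℝ L θ v - fderiv ℝ L ω v| :=
      (((hL.continuous_fderiv (by norm_num)).clm_apply continuous_const).sub
        continuous_const).abs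
    have := hc.tendsto ω
    simp only [sub_self, abs_zero] at this
    exact this.eventually_lt_const he
  have c3 := ((hL.differentiable (by norm_num)) ω).hasFDerivAt.isLittleO.def hε
  obtain ⟨T, hT, hB⟩ := Metric.eventually_nhds_iff.1 (c1.and (c2.and c3))
  refine ⟨T / 2, by positivity, fun θ hθ => ?_⟩
  have hx : |θ.1 - ω.1| ≤ T / 2 :=
    abs_le_of_sq_le_sq (by nlinarith [sq_nonneg (θ.2 - ω.2)]) (by positivity)
  have hy : |θ.2 - ω.2| ≤ T / 2 :=
    abs_le_of_sq_le_sq (by nlinarith [sq_nonneg (θ.1 - ω.1)]) (by positivity)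
  have hd : dist θ ω < T := by
    rw [Prod.dist_eq, max_lt_iff, Real.dist_eq, Real.dist_eq]
    constructor <;> linarith
  obtain ⟨b1, b2, b3⟩ := hB hd
  refine ⟨b1.le, b2.le, ?_⟩
  have e : fderiv ℝ L ω (θ - ω) =
      fderiv ℝ L ω (1, 0) * (θ.1 - ω.1) + fderiv ℝ L ω (0, 1) * (θ.2 - ω.2) := by
    have : θ - ω = (θ.1 - ω.1) • ((1, 0) : ℝ × ℝ) + (θ.2 - ω.2) • ((0, 1) : ℝ × ℝ) := by
      ext <;> simp
    rw [this, map_add, map_smul, map_smul, smul_eq_mul, smul_eq_mul]; ring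
  rw [← e]
  rw [h0, sub_zero, Real.norm_eq_abs] at b3
  rw [h0] at *
  refine b3.trans (mul_le_mul_of_nonneg_left ?_ hε.le)
  rw [Prod.norm_def]
  exact max_le (by simp) (by simp)

lemma enorm2_bd (x y δ : ℝ) (h : enorm2 (x, y) ≤ δ) : |x| ≤ δ ∧ |y| ≤ δ := by
  unfold enorm2 at h
  exact ⟨(Real.abs_le_sqrt (by simp; positivity)).trans h,
    (Real.abs_le_sqrt (by simp; positivity)).trans h⟩

theorem stmt10 (L₁ L₂ : ℝ × ℝ → ℝ)
    (hL₁ : ContDiff ℝ 1 L₁) (hL₂ : ContDiff ℝ 1 L₂)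
    (hL₁per₁ : ∀ θ : ℝ × ℝ, L₁ (θ.1 + 2 * π, θ.2) = L₁ θ)
    (hL₁per₂ : ∀ θ : ℝ × ℝ, L₁ (θ.1, θ.2 + 2 * π) = L₁ θ)
    (hL₂per₁ : ∀ θ : ℝ × ℝ, L₂ (θ.1 + 2 * π, θ.2) = L₂ θ)
    (hL₂per₂ : ∀ θ : ℝ × ℝ, L₂ (θ.1, θ.2 + 2 * π) = L₂ θ)
    (F₁ F₂ G₁ G₂ : ℝ × ℝ → ℝ × ℝ → ℝ)
    (hFcont : ContinuousOn (fun p : (ℝ × ℝ) × ℝ × ℝ => (F₁ p.1 p.2, F₂ p.1 p.2))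
      {p : (ℝ × ℝ) × ℝ × ℝ | 0 < p.2.1 ∧ 0 < p.2.2})
    (hGcont : ContinuousOn (fun p : (ℝ × ℝ) × ℝ × ℝ => (G₁ p.1 p.2, G₂ p.1 p.2))
      {p : (ℝ × ℝ) × ℝ × ℝ | 0 < p.2.1 ∧ 0 < p.2.2})
    (hFper : ∀ θ r : ℝ × ℝ, F₁ (θ.1 + 2 * π, θ.2) r = F₁ θ r ∧ F₁ (θ.1, θ.2 + 2 * π) r = F₁ θ r ∧
      F₂ (θ.1 + 2 * π, θ.2) r = F₂ θ r ∧ F₂ (θ.1, θ.2 + 2 * π) r = F₂ θ r)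
    (hGper : ∀ θ r : ℝ × ℝ, G₁ (θ.1 + 2 * π, θ.2) r = G₁ θ r ∧ G₁ (θ.1, θ.2 + 2 * π) r = G₁ θ r ∧
      G₂ (θ.1 + 2 * π, θ.2) r = G₂ θ r ∧ G₂ (θ.1, θ.2 + 2 * π) r = G₂ θ r)
    (hsmall : ∀ δ > (0 : ℝ), ∃ M > (0 : ℝ), ∀ θ r : ℝ × ℝ, 0 < r.1 → 0 < r.2 →
      M ≤ min r.1 r.2 → enorm2 (F₁ θ r, F₂ θ r) ≤ δ ∧ enorm2 (G₁ θ r, G₂ θ r) ≤ δ)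
    (ω : ℝ × ℝ) (hω₁ : L₁ ω = 0) (hω₂ : L₂ ω = 0)
    -- the Jacobian matrix JL(ω) is a D⁺-matrix
    (hD11 : fderiv ℝ L₁ ω (1, 0) < 0) (hD22 : fderiv ℝ L₂ ω (0, 1) < 0)
    (hDmix : |fderiv ℝ L₁ ω (0, 1) * fderiv ℝ L₂ ω (0, 1) +
        fderiv ℝ L₁ ω (1, 0) * fderiv ℝ L₂ ω (1, 0)| <
      2 * (fderiv ℝ L₁ ω (1, 0) * fderiv ℝ L₂ ω (0, 1)))
    -- the map f
    (f : (ℝ × ℝ) × ℝ × ℝ → (ℝ × ℝ) × ℝ × ℝ)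
    (hf : ∀ θ r : ℝ × ℝ, f (θ, r) =
      ((θ.1 + (L₁ θ + G₁ θ r) / r.1, θ.2 + (L₂ θ + G₂ θ r) / r.2),
       (r.1 - fderiv ℝ L₁ θ (1, 0) + F₁ θ r, r.2 - fderiv ℝ L₂ θ (0, 1) + F₂ θ r))) :
    ∃ R > (0 : ℝ), ∃ Θ : ℝ, 0 < Θ ∧ Θ < π ∧ ∃ lam > (0 : ℝ), ∃ η : ℝ, 0 < η ∧ η < lam ∧
      ∀ p : (ℝ × ℝ) × ℝ × ℝ,
        p ∈ {q : (ℝ × ℝ) × ℝ × ℝ | R ≤ q.2.1 ∧ R ≤ q.2.2 ∧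
          lam - η ≤ q.2.1 / q.2.2 ∧ q.2.1 / q.2.2 ≤ lam + η ∧ torusDist q.1 ω ≤ Θ} →
        (∀ k : ℕ, f^[k] p ∈ {q : (ℝ × ℝ) × ℝ × ℝ | R ≤ q.2.1 ∧ R ≤ q.2.2 ∧
          lam - η ≤ q.2.1 / q.2.2 ∧ q.2.1 / q.2.2 ≤ lam + η ∧ torusDist q.1 ω ≤ Θ}) ∧
        Tendsto (fun k : ℕ => (f^[k] p).2.1) atTop atTop ∧
        Tendsto (fun k : ℕ => (f^[k] p).2.2) atTop atTop := by
  obtain ⟨a, hadef⟩ : ∃ a, a = -fderiv ℝ L₁ ω (1, 0) := ⟨_, rfl⟩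
  obtain ⟨d, hddef⟩ : ∃ d, d = -fderiv ℝ L₂ ω (0, 1) := ⟨_, rfl⟩
  obtain ⟨b, hbdef⟩ : ∃ b, b = fderiv ℝ L₁ ω (0, 1) := ⟨_, rfl⟩
  obtain ⟨c, hcdef⟩ : ∃ c, c = fderiv ℝ L₂ ω (1, 0) := ⟨_, rfl⟩
  have ha' : fderiv ℝ L₁ ω (1, 0) = -a := by linarith
  have hd' : fderiv ℝ L₂ ω (0, 1) = -d := by linarith
  have ha : 0 < a := by linarith
  have hd : 0 < d := by linarith
  have hmix : |b * d + a * c| < 2 * (a * d) := by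
    rw [ha', hd', ← hbdef, ← hcdef] at hDmix
    rw [show b * -d + -a * c = -(b * d + a * c) by ring, abs_neg] at hDmix
    linarith
  obtain ⟨κ, hκ, τ, hτ, ε, hε, hquad⟩ := quad_neg a b c d ha hd hmix
  obtain ⟨lam, hlamdef⟩ : ∃ lam, lam = a / d := ⟨_, rfl⟩
  have hlam : 0 < lam := by rw [hlamdef]; positivity
  have hlamd : lam * d = a := by rw [hlamdef]; field_simp
  -- choose η
  obtain ⟨η', hη', hinv⟩ := Metric.continuousAt_iff.1 (continuousAt_inv₀ hlam.ne') τ hτ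
  obtain ⟨η, hη, hη1, hη2⟩ : ∃ η > 0, η < η' ∧ η < lam :=
    ⟨min η' lam / 2, by positivity, by linarith [min_le_left η' lam, lt_min hη' hlam],
      by linarith [min_le_right η' lam, lt_min hη' hlam]⟩
  -- choose e
  obtain ⟨e, he, he1, he2, he3⟩ : ∃ e > 0, 2 * e ≤ a ∧ 2 * e ≤ d ∧
      e * (1 + lam + η) ≤ η * d := by
    have hp : 0 < 1 + lam + η := by positivity
    refine ⟨min (min (a / 2) (d / 2)) (η * d / (1 + lam + η)), by positivity, ?_, ?_, ?_⟩
    · linarith [min_le_left (min (a / 2) (d / 2)) (η * d / (1 + lam + η)),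
        min_le_left (a / 2) (d / 2)]
    · linarith [min_le_left (min (a / 2) (d / 2)) (η * d / (1 + lam + η)),
        min_le_right (a / 2) (d / 2)]
    · rw [← le_div_iff₀ hp]; exact min_le_right _ _
  -- choose Θ
  obtain ⟨T1, hT1, hloc1⟩ := local_ctrl L₁ hL₁ ω (1, 0) hω₁ ε (e / 2) hε (by positivity)
  obtain ⟨T2, hT2, hloc2⟩ := local_ctrl L₂ hL₂ ω (0, 1) hω₂ ε (e / 2) hε (by positivity)
  obtain ⟨T, hT, hTT1, hTT2, hTpi⟩ : ∃ T > 0, T ≤ T1 ∧ T ≤ T2 ∧ T < π :=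
    ⟨min (min T1 T2) 3, by positivity, (min_le_left _ _).trans (min_le_left _ _),
      (min_le_left _ _).trans (min_le_right _ _),
      (min_le_right _ _).trans_lt Real.pi_gt_three⟩
  -- choose δ, R
  obtain ⟨N, hNdef⟩ : ∃ N, N = d / a + τ := ⟨_, rfl⟩
  have hN : 0 < N := by rw [hNdef]; positivity
  obtain ⟨δ, hδ, hδ1, hδ2, hδ3⟩ : ∃ δ > 0, δ ≤ 1 ∧ δ ≤ e / 2 ∧ 2 * ((N + 1) * δ) ≤ κ * T := by
    refine ⟨min (min 1 (e / 2)) (κ * T / (2 * (N + 1))), by positivity,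
      (min_le_left _ _).trans (min_le_left _ _), (min_le_left _ _).trans (min_le_right _ _), ?_⟩
    have := min_le_right (min 1 (e / 2)) (κ * T / (2 * (N + 1)))
    rw [le_div_iff₀ (by positivity)] at this
    linarith
  obtain ⟨M, hM, hFG⟩ := hsmall δ hδ
  obtain ⟨R, hR, hRM, hR1, hR2⟩ : ∃ R > 0, M ≤ R ∧ 2 * κ ≤ R ∧
      4 * (N ^ 2 + 1) ≤ R * (κ * T ^ 2) := by
    refine ⟨max (max M (2 * κ)) (4 * (N ^ 2 + 1) / (κ * T ^ 2)), by positivity,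
      (le_max_left _ _).trans (le_max_left _ _), (le_max_right _ _).trans (le_max_left _ _), ?_⟩
    rw [← div_le_iff₀ (by positivity)]; exact le_max_right _ _
  refine ⟨R, hR, T, hT, hTpi, lam, hlam, η, hη, hη2, ?_⟩
  set E : Set ((ℝ × ℝ) × ℝ × ℝ) := {q : (ℝ × ℝ) × ℝ × ℝ | R ≤ q.2.1 ∧ R ≤ q.2.2 ∧
          lam - η ≤ q.2.1 / q.2.2 ∧ q.2.1 / q.2.2 ≤ lam + η ∧ torusDist q.1 ω ≤ T} with hE
  have step : ∀ p ∈ E, f p ∈ E ∧ p.2.1 + e ≤ (f p).2.1 ∧ p.2.2 + e ≤ (f p).2.2 := by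
    rintro ⟨θ, r, q⟩ ⟨h1, h2, h3, h4, h5⟩
    simp only at h1 h2 h3 h4 h5
    have hr0 : 0 < r := hR.trans_le h1
    have hq0 : 0 < q := hR.trans_le h2
    rw [torus_le_iff _ _ _ hT.le] at h5
    obtain ⟨k, l, hkl⟩ := h5
    obtain ⟨hF, hG⟩ := hFG θ (r, q) hr0 hq0 (le_min (hRM.trans h1) (hRM.trans h2))
    obtain ⟨hF1, hF2⟩ := enorm2_bd _ _ _ hF
    obtain ⟨hG1, hG2⟩ := enorm2_bd _ _ _ hG
    have q1 := per_int L₁ hL₁per₁ hL₁per₂ k l θ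
    have q2 := per_int L₂ hL₂per₁ hL₂per₂ k l θ
    have q3 := fderiv_per_int L₁ hL₁per₁ hL₁per₂ k l θ
    have q4 := fderiv_per_int L₂ hL₂per₁ hL₂per₂ k l θ
    obtain ⟨x, hx⟩ : ∃ x, x = θ.1 - ω.1 + 2 * k * π := ⟨_, rfl⟩
    obtain ⟨y, hy⟩ : ∃ y, y = θ.2 - ω.2 + 2 * l * π := ⟨_, rfl⟩
    have hx' : (θ + (2 * (k : ℝ) * π, 2 * (l : ℝ) * π)).1 - ω.1 = x := by
      rw [hx, Prod.fst_add]; ring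
    have hy' : (θ + (2 * (k : ℝ) * π, 2 * (l : ℝ) * π)).2 - ω.2 = y := by
      rw [hy, Prod.snd_add]; ring
    rw [← hx, ← hy] at hkl
    have l1 := hloc1 (θ + (2 * (k : ℝ) * π, 2 * (l : ℝ) * π))
    have l2 := hloc2 (θ + (2 * (k : ℝ) * π, 2 * (l : ℝ) * π))
    rw [hx', hy', q1, q3, ha', ← hbdef] at l1
    rw [hx', hy', q2, q4, hd', ← hcdef] at l2
    obtain ⟨l11, l12, l13⟩ := l1 (hkl.trans (by gcongr))
    obtain ⟨l21, l22, l23⟩ := l2 (hkl.trans (by gcongr))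
    have hν : |q / r - d / a| ≤ τ := by
      have := hinv (x := r / q) (by
        rw [Real.dist_eq, abs_lt]; constructor <;> linarith)
      rw [Real.dist_eq, inv_div, hlamdef, inv_div] at this
      exact this.le
    have hνN : q / r ≤ N := by rw [hNdef]; linarith [(abs_le.1 hν).2]
    have hQ := hquad (q / r) x y (L₁ θ - (-a * x + b * y)) (L₂ θ - (c * x + -d * y))
      (by positivity) hν l13 l23
    rw [add_sub_cancel, show c * x - d * y + (L₂ θ - (c * x + -d * y)) = L₂ θ by ring] at hQ
    have hang := ang_step κ N δ T R hκ hN hT hδ3 hR1 hR2 x y (L₁ θ) (L₂ θ) (G₁ θ (r, q))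
      (G₂ θ (r, q)) r q hr0 hq0 h2 hνN hkl hG1 hG2
      ((abs_add_le _ _).trans (by linarith)) ((abs_add_le _ _).trans (by linarith)) hQ
    have hA : |(- fderiv ℝ L₁ θ (1, 0) + F₁ θ (r, q)) - a| ≤ e := by
      rw [abs_le] at *
      constructor <;> linarith
    have hB : |(- fderiv ℝ L₂ θ (0, 1) + F₂ θ (r, q)) - d| ≤ e := by
      rw [abs_le] at *
      constructor <;> linarith
    obtain ⟨s1, s2, s3, s4⟩ := rad_step a d lam η e hlamd hη hη2 he1 he2 he3 he r q _ _
      hr0 hq0 hA hB h3 h4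
    rw [hf]
    simp only [hE, Set.mem_setOf_eq]
    rw [show r - fderiv ℝ L₁ θ (1, 0) + F₁ θ (r, q) =
      r + (- fderiv ℝ L₁ θ (1, 0) + F₁ θ (r, q)) by ring,
      show q - fderiv ℝ L₂ θ (0, 1) + F₂ θ (r, q) =
      q + (- fderiv ℝ L₂ θ (0, 1) + F₂ θ (r, q)) by ring]
    refine ⟨⟨by linarith, by linarith, s3, s4, ?_⟩, s1, s2⟩
    rw [torus_le_iff _ _ _ hT.le]
    refine ⟨k, l, ?_⟩
    simp only
    convert hang using 3
    · rw [hx]; ring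
    · rw [hy]; ring
  intro p hp
  have hall : ∀ k : ℕ, f^[k] p ∈ E := by
    intro k
    induction k with
    | zero => exact hp
    | succ k ih => rw [Function.iterate_succ_apply']; exact (step _ ih).1
  have lin1 : ∀ k : ℕ, (k : ℝ) * e ≤ (f^[k] p).2.1 := by
    intro k
    induction k with
    | zero => simpa using hR.le.trans hp.1
    | succ k ih =>
      rw [Function.iterate_succ_apply']
      have := (step _ (hall k)).2.1
      push_cast
      linarith
  have lin2 : ∀ k : ℕ, (k : ℝ) * e ≤ (f^[k] p).2.2 := by
    intro k
    induction k with
    | zero => simpa using hR.le.trans hp.2.1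
    | succ k ih =>
      rw [Function.iterate_succ_apply']
      have := (step _ (hall k)).2.2
      push_cast
      linarith
  have ht : Tendsto (fun k : ℕ => (k : ℝ) * e) atTop atTop :=
    tendsto_natCast_atTop_atTop.atTop_mul_const he
  exact ⟨hall, tendsto_atTop_mono lin1 ht, tendsto_atTop_mono lin2 ht⟩
end
end
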